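/- Let n ≥ 1 and let P be the ladder on n elements, i.e., the poset on {1,…,n} in which i < j iff i + 2 ≤ j. Then lim_{L→∞} V_P(L)/L = n·A_{n−1}, where A_{n−1} is the number of down-up alternating permutations of {1,…,n−1} (with A_0 = 1). In other words, L^n times the probability that n i.i.d. uniform points on [0,L] generate the ladder is asymptotic to n·A_{n−1}·L. -/

import Mathlib

open MeasureTheory Set Filter

/-- A unit interval representation of a poset. -/
def UnitRep {α : Type*} [Preorder α] (f : α → ℝ) : Prop :=
  ∀ x y : α, x < y ↔ f x + 1 < f y

/-- A poset is a semiorder if it admits a unit interval representation. -/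
def IsSemiorder (α : Type*) [Preorder α] : Prop :=
  ∃ f : α → ℝ, UnitRep f

/-- A poset is a brick if its ground set cannot be partitioned into two nonempty
parts `A`, `B` with every element of `A` below every element of `B`. -/
def IsBrick (α : Type*) [Preorder α] : Prop :=
  ¬ ∃ A B : Set α, A.Nonempty ∧ B.Nonempty ∧ (∀ x, x ∈ A ∨ x ∈ B) ∧
      (∀ x, ¬ (x ∈ A ∧ x ∈ B)) ∧ ∀ a ∈ A, ∀ b ∈ B, a < b

/-- `genVol r L` is the volume of the set of tuples `x ∈ [0,L]^α` such that the
relation `i ≺ j ↔ x i + 1 < x j` on the index set is isomorphic to `r`. -/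
noncomputable def genVol {α : Type*} [Fintype α] (r : α → α → Prop) (L : ℝ) : ℝ :=
  (volume {x : α → ℝ | (∀ i, x i ∈ Icc (0:ℝ) L) ∧
      ∃ e : α ≃ α, ∀ a b : α, r a b ↔ x (e a) + 1 < x (e b)}).toReal

/-- `altCount m` is the number of down-up alternating permutations of `{1, …, m}`
(`σ 1 > σ 2 < σ 3 > ⋯`), i.e. the Euler up/down number `A_m`. -/
noncomputable def altCount (m : ℕ) : ℕ :=
  Nat.card {σ : Equiv.Perm (Fin m) //
    ∀ i : Fin m, ∀ h : i.val + 1 < m,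
      if i.val % 2 = 0 then σ ⟨i.val + 1, h⟩ < σ i else σ i < σ ⟨i.val + 1, h⟩}

lemma lv_ae_inj (n : ℕ) : ∀ᵐ x : Fin n → ℝ, Function.Injective x := by
  have h : ∀ i j : Fin n, i ≠ j → ∀ᵐ x : Fin n → ℝ, x i ≠ x j := by
    intro i j hij
    let s : Submodule ℝ (Fin n → ℝ) :=
      LinearMap.ker (LinearMap.proj (R := ℝ) (φ := fun _ : Fin n => ℝ) i - LinearMap.proj j)
    have hs : s ≠ ⊤ := by
      intro h
      have : (Pi.single i (1:ℝ) : Fin n → ℝ) ∈ s := by rw [h]; trivial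
      simp [s, LinearMap.mem_ker, hij.symm] at this
    have := Measure.addHaar_submodule (volume : Measure (Fin n → ℝ)) s hs
    rw [ae_iff]
    refine measure_mono_null ?_ this
    intro x hx
    simp only [ne_eq, not_not, mem_ofPred_eq] at hx
    simp [s, LinearMap.mem_ker, hx]
  have h2 : ∀ᵐ x : Fin n → ℝ, ∀ i j : Fin n, i ≠ j → x i ≠ x j := by
    rw [ae_all_iff]; intro i; rw [ae_all_iff]; intro j
    by_cases hij : i = j
    · simp [hij]
    · filter_upwards [h i j hij] with x hx _ using hx
  filter_upwards [h2] with x hx i j hij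
  by_contra hne
  exact hx i j hne hij

lemma lv_ae_ne0 (n : ℕ) : ∀ᵐ x : Fin n → ℝ, ∀ i, x i ≠ 0 := by
  rw [ae_all_iff]; intro i
  let s : Submodule ℝ (Fin n → ℝ) :=
      LinearMap.ker (LinearMap.proj (R := ℝ) (φ := fun _ : Fin n => ℝ) i)
  have hs : s ≠ ⊤ := by
    intro h
    have : (Pi.single i (1:ℝ) : Fin n → ℝ) ∈ s := by rw [h]; trivial
    simp [s, LinearMap.mem_ker] at this
  have := Measure.addHaar_submodule (volume : Measure (Fin n → ℝ)) s hs
  rw [ae_iff]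
  refine measure_mono_null ?_ this
  intro x hx
  simp only [ne_eq, not_not, mem_ofPred_eq] at hx
  simp [s, LinearMap.mem_ker, hx]

lemma lv_perm {n : ℕ} (σ : Equiv.Perm (Fin n)) (A : Set (Fin n → ℝ)) :
    volume {x : Fin n → ℝ | x ∘ σ ∈ A} = volume A := by
  have h := volume_measurePreserving_piCongrLeft (fun _ : Fin n => ℝ) σ.symm
  have := h.measure_preimage_equiv A
  rw [← this]
  congr 1
  ext x
  simp only [mem_ofPred_eq, mem_preimage]
  have : x ∘ σ = (MeasurableEquiv.piCongrLeft (fun _ : Fin n => ℝ) σ.symm) x := by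
    ext i
    obtain ⟨j, rfl⟩ := σ.symm.surjective i
    simp [MeasurableEquiv.coe_piCongrLeft, Equiv.piCongrLeft_apply_apply]
  rw [this]

lemma lv_union {n : ℕ} (S : Finset (Equiv.Perm (Fin n))) (A : Set (Fin n → ℝ))
    (hA : MeasurableSet A) (hm : ∀ x ∈ A, StrictMono x) :
    volume {x : Fin n → ℝ | ∃ σ ∈ S, x ∘ σ ∈ A} = S.card * volume A := by
  have : {x : Fin n → ℝ | ∃ σ ∈ S, x ∘ σ ∈ A} = ⋃ σ ∈ S, {x : Fin n → ℝ | x ∘ σ ∈ A} := by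
    ext x; simp
  rw [this, measure_biUnion_finset]
  · simp [lv_perm]
  · intro σ _ τ _ hst
    rw [Function.onFun, Set.disjoint_left]
    intro x hx hy
    apply hst
    have h1 := hm _ hx
    have h2 := hm _ hy
    have h3 : x ∘ σ = x ∘ τ := by
      rw [← StrictMono.range_inj h1 h2]
      simp [Set.range_comp]
    have hinj : Function.Injective x := by
      have : x = (x ∘ σ) ∘ σ.symm := by ext; simp
      rw [this]
      exact h1.injective.comp σ.symm.injective
    ext i
    exact congrArg _ (hinj (congrFun h3 i))
  · intro σ _
    have : Measurable (fun x : Fin n → ℝ => x ∘ σ) := by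
      rw [measurable_pi_iff]; intro i; exact measurable_pi_apply _
    exact this hA

def lvC (m : ℕ) : Set (Fin m → ℝ) := {y | StrictMono y ∧ ∀ i, y i ∈ Icc (0:ℝ) 1}

lemma lv_meas_sm (m : ℕ) : MeasurableSet {y : Fin m → ℝ | StrictMono y} := by
  have : {y : Fin m → ℝ | StrictMono y} = ⋂ i, ⋂ j, ⋂ (_ : i < j), {y | y i < y j} := by
    ext y; simp [StrictMono]
  rw [this]
  refine MeasurableSet.iInter fun i => MeasurableSet.iInter fun j => MeasurableSet.iInter fun _ => ?_
  exact measurableSet_lt (measurable_pi_apply _) (measurable_pi_apply _)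

lemma lv_meas_cube (m : ℕ) (L : ℝ) : MeasurableSet {y : Fin m → ℝ | ∀ i, y i ∈ Icc (0:ℝ) L} := by
  rw [Set.ofPred_forall]
  exact MeasurableSet.iInter fun i => (measurable_pi_apply i) measurableSet_Icc

lemma lv_measC (m : ℕ) : MeasurableSet (lvC m) :=
  (lv_meas_sm m).inter (lv_meas_cube m 1)

lemma lv_sort {m : ℕ} (x : Fin m → ℝ) (hx : Function.Injective x) :
    StrictMono (x ∘ Tuple.sort x) :=
  (Tuple.monotone_sort x).strictMono_of_injective (hx.comp (Tuple.sort x).injective)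

lemma lv_volC (m : ℕ) : (m.factorial : ENNReal) * volume (lvC m) = 1 := by
  have h := lv_union (Finset.univ : Finset (Equiv.Perm (Fin m))) (lvC m) (lv_measC m) (fun x hx => hx.1)
  rw [Finset.card_univ, Fintype.card_perm, Fintype.card_fin] at h
  rw [← h]
  have h1 : volume {y : Fin m → ℝ | ∀ i, y i ∈ Icc (0:ℝ) 1} = 1 := by
    have : {y : Fin m → ℝ | ∀ i, y i ∈ Icc (0:ℝ) 1} = Set.pi univ (fun _ => Icc (0:ℝ) 1) := by
      ext; simp only [Set.mem_pi, Set.mem_univ, true_implies, Set.mem_ofPred_eq]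
    rw [this, volume_pi_pi]; simp
  rw [← h1]
  apply measure_congr
  filter_upwards [lv_ae_inj m] with x hx
  apply propext
  change (∃ σ ∈ (Finset.univ : Finset (Equiv.Perm (Fin m))), x ∘ σ ∈ lvC m) ↔ ∀ i, x i ∈ Icc (0:ℝ) 1
  constructor
  · rintro ⟨σ, -, h⟩ i
    simpa using h.2 (σ.symm i)
  · intro h
    exact ⟨Tuple.sort x, Finset.mem_univ _, lv_sort x hx, fun i => h _⟩

def lvAlt {m : ℕ} {α : Type*} [LT α] (y : Fin m → α) : Prop :=
  ∀ i : Fin m, ∀ h : i.val + 1 < m,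
      if i.val % 2 = 0 then y ⟨i.val + 1, h⟩ < y i else y i < y ⟨i.val + 1, h⟩

lemma lv_volY (m : ℕ) :
    volume {y : Fin m → ℝ | (∀ i, y i ∈ Icc (0:ℝ) 1) ∧ lvAlt y} = altCount m * volume (lvC m) := by
  classical
  let S : Finset (Equiv.Perm (Fin m)) := Finset.univ.filter fun σ => lvAlt (⇑(σ⁻¹))
  have hS : S.card = altCount m := by
    unfold altCount
    rw [← Nat.card_eq_finsetCard]
    refine Nat.card_congr ((Equiv.inv (Equiv.Perm (Fin m))).subtypeEquiv ?_)
    intro σ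
    simp [S, lvAlt]
  rw [← hS, ← lv_union S (lvC m) (lv_measC m) (fun x hx => hx.1)]
  apply measure_congr
  filter_upwards [lv_ae_inj m] with x hx
  apply propext
  change ((∀ i, x i ∈ Icc (0:ℝ) 1) ∧ lvAlt x) ↔ (∃ σ ∈ S, x ∘ σ ∈ lvC m)
  have key : ∀ σ : Equiv.Perm (Fin m), StrictMono (x ∘ σ) → (lvAlt x ↔ lvAlt (⇑(σ⁻¹))) := by
    intro σ hs
    have : ∀ i j, x i < x j ↔ σ⁻¹ i < σ⁻¹ j := by
      intro i j
      have := hs.lt_iff_lt (a := σ⁻¹ i) (b := σ⁻¹ j)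
      simpa using this
    simp only [lvAlt, this]
  constructor
  · rintro ⟨h1, h2⟩
    refine ⟨Tuple.sort x, ?_, lv_sort x hx, fun i => h1 _⟩
    simp only [S, Finset.mem_filter, Finset.mem_univ, true_and]
    exact (key _ (lv_sort x hx)).1 h2
  · rintro ⟨σ, hσ, h⟩
    simp only [S, Finset.mem_filter, Finset.mem_univ, true_and] at hσ
    exact ⟨fun i => by simpa using h.2 (σ.symm i), (key σ h.1).2 hσ⟩

def lvG (m : ℕ) : Set (Fin m → ℝ) :=
  {g | (∀ i, g i ∈ Ioc (0:ℝ) 1) ∧ ∀ i : Fin m, ∀ h : i.val + 1 < m, 1 < g i + g ⟨i.val + 1, h⟩}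

lemma lv_measY (m : ℕ) : MeasurableSet {y : Fin m → ℝ | (∀ i, y i ∈ Icc (0:ℝ) 1) ∧ lvAlt y} := by
  refine (lv_meas_cube m 1).inter ?_
  change MeasurableSet {y : Fin m → ℝ | ∀ i : Fin m, ∀ h : i.val + 1 < m,
      if i.val % 2 = 0 then y ⟨i.val + 1, h⟩ < y i else y i < y ⟨i.val + 1, h⟩}
  rw [Set.ofPred_forall]
  refine MeasurableSet.iInter fun i => ?_
  rw [Set.ofPred_forall]
  refine MeasurableSet.iInter fun h => ?_
  split_ifs
  · exact measurableSet_lt (measurable_pi_apply _) (measurable_pi_apply _)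
  · exact measurableSet_lt (measurable_pi_apply _) (measurable_pi_apply _)

lemma lv_volG (m : ℕ) : volume (lvG m) = altCount m * volume (lvC m) := by
  rw [← lv_volY]
  let f : Fin m → ℝ → ℝ := fun i t => if i.val % 2 = 0 then t else 1 - t
  have hf : ∀ i, MeasurePreserving (f i) volume volume := by
    intro i
    by_cases h : i.val % 2 = 0
    · simp only [f, h, if_true]; exact MeasurePreserving.id _
    · simp only [f, h, if_false]; exact Measure.measurePreserving_sub_left volume 1
  have hp := volume_preserving_pi hf
  rw [← hp.measure_preimage (lv_measY m).nullMeasurableSet]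
  apply measure_congr
  filter_upwards [lv_ae_ne0 m] with g hg
  apply propext
  change ((∀ i, g i ∈ Ioc (0:ℝ) 1) ∧ ∀ i : Fin m, ∀ h : i.val + 1 < m, 1 < g i + g ⟨i.val + 1, h⟩) ↔
    ((∀ i, f i (g i) ∈ Icc (0:ℝ) 1) ∧ lvAlt (fun i => f i (g i)))
  refine and_congr (forall_congr' fun i => ?_) (forall_congr' fun i => forall_congr' fun h => ?_)
  · have := hg i
    simp only [f, mem_Ioc, mem_Icc]
    split_ifs
    · exact ⟨fun h => ⟨h.1.le, h.2⟩, fun h => ⟨lt_of_le_of_ne h.1 this.symm, h.2⟩⟩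
    · exact ⟨fun h => ⟨by linarith, by linarith⟩,
        fun h => ⟨lt_of_le_of_ne (by linarith) this.symm, by linarith⟩⟩
  · simp only [f]
    by_cases h0 : i.val % 2 = 0
    · have h1 : ¬ (i.val + 1) % 2 = 0 := by omega
      simp only [h0, h1, if_true, if_false]
      constructor <;> intro <;> linarith
    · have h1 : (i.val + 1) % 2 = 0 := by omega
      simp only [h0, h1, if_true, if_false]
      constructor <;> intro <;> linarith

def lvPsi (m : ℕ) : (Fin (m+1) → ℝ) →ₗ[ℝ] (Fin (m+1) → ℝ) where
  toFun x := Fin.cons (x 0) (fun j : Fin m => x j.succ - x j.castSucc)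
  map_add' x y := by
    ext i; refine Fin.cases ?_ (fun j => ?_) i
    · simp
    · simp; ring
  map_smul' c x := by
    ext i; refine Fin.cases ?_ (fun j => ?_) i
    · simp
    · simp; ring

lemma lv_det (m : ℕ) : LinearMap.det (lvPsi m) = 1 := by
  rw [← LinearMap.det_toMatrix', Matrix.det_of_isLowerTriangular]
  · apply Finset.prod_eq_one
    intro i _
    rw [LinearMap.toMatrix'_apply]
    refine Fin.cases ?_ (fun j => ?_) i
    · simp [lvPsi]
    · simp [lvPsi, Pi.single_apply, Fin.ext_iff]
  · intro i j hij
    rw [LinearMap.toMatrix'_apply]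
    have hij : i < j := hij
    revert hij
    refine Fin.cases ?_ (fun k => ?_) i
    · intro hij
      simp [lvPsi, Pi.single_apply, hij.ne]
    · intro hij
      have h1 : k.succ ≠ j := hij.ne
      have h2 : k.castSucc ≠ j := (lt_trans Fin.castSucc_lt_succ hij).ne
      simp [lvPsi, Pi.single_apply, h1, h2]

lemma lv_box (m : ℕ) (L : ℝ) :
    volume {x : Fin (m+1) → ℝ | x 0 ∈ Icc 0 L ∧ (fun j : Fin m => x j.succ - x j.castSucc) ∈ lvG m}
      = ENNReal.ofReal L * volume (lvG m) := by
  have h1 := Measure.addHaar_preimage_linearMap (volume : Measure (Fin (m+1) → ℝ))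
    (f := lvPsi m) (by rw [lv_det]; norm_num)
    {h : Fin (m+1) → ℝ | h 0 ∈ Icc 0 L ∧ (fun j : Fin m => h j.succ) ∈ lvG m}
  rw [lv_det] at h1
  simp only [inv_one, abs_one, ENNReal.ofReal_one, one_mul] at h1
  have h2 := (volume_preserving_piFinSuccAbove (fun _ : Fin (m+1) => ℝ) 0).measure_preimage_equiv
    (Icc (0:ℝ) L ×ˢ lvG m)
  rw [Measure.volume_eq_prod, Measure.prod_prod, Real.volume_Icc, sub_zero] at h2
  rw [← h2]
  refine Eq.trans ?_ (h1.trans ?_)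
  · rfl
  · congr 1

def lvT (n : ℕ) (L : ℝ) : Set (Fin n → ℝ) :=
  {x | StrictMono x ∧ (∀ i, x i ∈ Icc (0:ℝ) L) ∧
    ∀ a b : Fin n, a.val + 2 ≤ b.val ↔ x a + 1 < x b}

lemma lv_measT (n : ℕ) (L : ℝ) : MeasurableSet (lvT n L) := by
  refine (lv_meas_sm n).inter ((lv_meas_cube n L).inter ?_)
  change MeasurableSet {x : Fin n → ℝ | ∀ a b : Fin n, a.val + 2 ≤ b.val ↔ x a + 1 < x b}
  rw [Set.ofPred_forall]
  refine MeasurableSet.iInter fun a => ?_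
  rw [Set.ofPred_forall]
  refine MeasurableSet.iInter fun b => ?_
  have hm : MeasurableSet {x : Fin n → ℝ | x a + 1 < x b} :=
    measurableSet_lt ((measurable_pi_apply _).add_const _) (measurable_pi_apply _)
  by_cases h : a.val + 2 ≤ b.val
  · simpa [h] using hm
  · simp only [h, false_iff]
    exact hm.compl

lemma lv_U (n : ℕ) (L : ℝ) :
    genVol (fun i j : Fin n => i.val + 2 ≤ j.val) L = n.factorial * (volume (lvT n L)).toReal := by
  have h := lv_union (Finset.univ : Finset (Equiv.Perm (Fin n))) (lvT n L) (lv_measT n L)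
    (fun x hx => hx.1)
  rw [Finset.card_univ, Fintype.card_perm, Fintype.card_fin] at h
  unfold genVol
  have : (n.factorial : ℝ) * (volume (lvT n L)).toReal = (n.factorial * volume (lvT n L)).toReal := by
    simp
  rw [this, ← h]
  congr 1
  apply measure_congr
  filter_upwards [lv_ae_inj n] with x hx
  apply propext
  change ((∀ i, x i ∈ Icc (0:ℝ) L) ∧
      ∃ e : Fin n ≃ Fin n, ∀ a b : Fin n, a.val + 2 ≤ b.val ↔ x (e a) + 1 < x (e b)) ↔
      ∃ σ ∈ (Finset.univ : Finset (Equiv.Perm (Fin n))), x ∘ σ ∈ lvT n L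
  constructor
  · rintro ⟨hc, e, he⟩
    by_cases hn : n ≤ 2
    · refine ⟨Tuple.sort x, Finset.mem_univ _, lv_sort x hx, fun i => hc _, ?_⟩
      have hno : ∀ a b : Fin n, ¬ (a.val + 2 ≤ b.val) := by intro a b; omega
      intro a b
      refine iff_of_false (hno a b) ?_
      have := (he (e.symm (Tuple.sort x a)) (e.symm (Tuple.sort x b))).not.1 (hno _ _)
      simpa using this
    · refine ⟨e, Finset.mem_univ _, ?_, fun i => hc _, he⟩
      intro a b hab
      have hab' : a.val < b.val := hab
      simp only [Function.comp]
      by_cases hb : b.val + 1 < n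
      · have h1 := (he a ⟨b.val + 1, hb⟩).1 (by simp; omega)
        have h2 := (he b ⟨b.val + 1, hb⟩).not.1 (by simp)
        linarith
      · have hbn := b.isLt
        by_cases ha : 1 ≤ a.val
        · have h1 := (he ⟨a.val - 1, by omega⟩ b).1 (by simp; omega)
          have h2 := (he ⟨a.val - 1, by omega⟩ a).not.1 (by simp; omega)
          linarith
        · have := (he a b).1 (by omega)
          linarith
  · rintro ⟨σ, -, h⟩
    exact ⟨fun i => by simpa using h.2.1 (σ.symm i), σ, h.2.2⟩

lemma lv_T_sub (m : ℕ) (L : ℝ) : lvT (m+1) L ⊆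
    {x : Fin (m+1) → ℝ | x 0 ∈ Icc 0 L ∧ (fun j : Fin m => x j.succ - x j.castSucc) ∈ lvG m} := by
  rintro x ⟨hs, hc, hr⟩
  refine ⟨hc 0, ?_, ?_⟩
  · intro i
    have h1 := hs (Fin.castSucc_lt_succ (i := i))
    have h2 := (hr i.castSucc i.succ).not.1 (by simp)
    constructor <;> simp only <;> linarith
  · intro i h
    have h1 := (hr i.castSucc (Fin.succ ⟨i.val + 1, h⟩)).1 (by simp)
    have h2 : (Fin.castSucc ⟨i.val + 1, h⟩ : Fin (m+1)) = i.succ := by ext; simp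
    simp only [h2]
    linarith

lemma lv_T_sup (m : ℕ) (L : ℝ) : 
    {x : Fin (m+1) → ℝ | x 0 ∈ Icc 0 (L - m) ∧ (fun j : Fin m => x j.succ - x j.castSucc) ∈ lvG m}
    ⊆ lvT (m+1) L := by
  rintro x ⟨h0, hg, hs⟩
  have hsm : StrictMono x := by
    rw [Fin.strictMono_iff_lt_succ]
    intro i
    have := (hg i).1
    simp only at this
    linarith
  have hle : ∀ i : Fin (m+1), x i ≤ x 0 + i.val := by
    intro i
    induction i using Fin.induction with
    | zero => simp
    | succ i ih =>
      have := (hg i).2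
      simp only [Fin.val_castSucc] at this ih
      simp only [Fin.val_succ]
      push_cast
      linarith
  refine ⟨hsm, ?_, ?_⟩
  · intro i
    have h1 := hsm.monotone (Fin.zero_le i)
    have h2 := hle i
    have h3 : (i.val : ℝ) ≤ m := by exact_mod_cast Nat.lt_succ_iff.1 i.isLt
    exact ⟨h0.1.trans h1, by linarith [h0.2]⟩
  · intro a b
    have hb := b.isLt
    constructor
    · intro hab
      have h1 := hs ⟨a.val, by omega⟩ (by simp; omega)
      have e1 : (Fin.castSucc ⟨a.val, by omega⟩ : Fin (m+1)) = a := by ext; simp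
      have e2 : (Fin.castSucc ⟨a.val + 1, by omega⟩ : Fin (m+1)) = Fin.succ ⟨a.val, by omega⟩ := by
        ext; simp
      simp only [e1, e2] at h1
      have h2 : x (Fin.succ ⟨a.val + 1, by omega⟩) ≤ x b := hsm.monotone (by
        rw [Fin.le_def]; simp; omega)
      linarith
    · intro hab
      by_contra hcon
      by_cases hle : b ≤ a
      · have := hsm.monotone hle
        linarith
      · rw [Fin.le_def] at hle
        have h1 := (hg ⟨a.val, by omega⟩).2
        have e1 : (Fin.castSucc ⟨a.val, by omega⟩ : Fin (m+1)) = a := by ext; simp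
        have e2 : (Fin.succ ⟨a.val, by omega⟩ : Fin (m+1)) = b := by ext; simp; omega
        simp only [e1, e2] at h1
        linarith

/-- For the ladder on `n` elements (`i < j` iff `i + 2 ≤ j`), `V_P(L)/L` tends to
`n·A_{n-1}`. -/
theorem ladder_volume_limit (n : ℕ) (hn : 1 ≤ n) :
    Tendsto (fun L : ℝ => genVol (fun i j : Fin n => i.val + 2 ≤ j.val) L / L) atTop
      (nhds ((n : ℝ) * (altCount (n - 1) : ℝ))) := by
  obtain ⟨m, rfl⟩ : ∃ m, n = m + 1 := ⟨n - 1, by omega⟩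
  simp only [Nat.add_sub_cancel]
  simp only [lv_U]
  have hC := lv_volC m
  have hCtop : volume (lvC m) ≠ ⊤ := by
    intro h
    rw [h, ENNReal.mul_top (by exact_mod_cast m.factorial_ne_zero)] at hC
    exact absurd hC (by simp)
  have hG : volume (lvG m) ≠ ⊤ := by
    rw [lv_volG]; exact ENNReal.mul_ne_top (by simp) hCtop
  have hGr : (m.factorial : ℝ) * (volume (lvG m)).toReal = altCount m := by
    have := congrArg ENNReal.toReal hC
    simp only [ENNReal.toReal_mul, ENNReal.toReal_natCast, ENNReal.toReal_one] at this
    rw [lv_volG]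
    simp only [ENNReal.toReal_mul, ENNReal.toReal_natCast]
    linear_combination (altCount m : ℝ) * this
  have hlim : ((m + 1 : ℕ) : ℝ) * (altCount m : ℝ)
      = ((m+1).factorial : ℝ) * (volume (lvG m)).toReal := by
    rw [← hGr, Nat.factorial_succ]; push_cast; ring
  rw [hlim]
  set c := (volume (lvG m)).toReal with hc
  have hup : ∀ L : ℝ, 0 < L → (volume (lvT (m+1) L)).toReal ≤ L * c := by
    intro L hL
    have := measure_mono (μ := volume) (lv_T_sub m L)
    rw [lv_box] at this
    have h2 := ENNReal.toReal_mono (ENNReal.mul_ne_top ENNReal.ofReal_ne_top hG) this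
    rwa [ENNReal.toReal_mul, ENNReal.toReal_ofReal hL.le] at h2
  have hlo : ∀ L : ℝ, (m:ℝ) < L → (L - m) * c ≤ (volume (lvT (m+1) L)).toReal := by
    intro L hL
    have := measure_mono (μ := volume) (lv_T_sup m L)
    rw [lv_box] at this
    have hfin : volume (lvT (m+1) L) ≠ ⊤ := by
      have := measure_mono (μ := volume) (lv_T_sub m L)
      rw [lv_box] at this
      exact ne_top_of_le_ne_top (ENNReal.mul_ne_top ENNReal.ofReal_ne_top hG) this
    have h2 := ENNReal.toReal_mono hfin this
    rwa [ENNReal.toReal_mul, ENNReal.toReal_ofReal (by linarith)] at h2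
  simp only [mul_div_assoc]
  apply Tendsto.const_mul
  have hl : Tendsto (fun L : ℝ => c - (m * c) / L) atTop (nhds c) := by
    have : Tendsto (fun L : ℝ => (m * c) / L) atTop (nhds 0) := tendsto_const_nhds.div_atTop tendsto_id
    simpa using tendsto_const_nhds.sub this
  refine tendsto_of_tendsto_of_tendsto_of_le_of_le' hl tendsto_const_nhds ?_ ?_
  · filter_upwards [eventually_gt_atTop (m:ℝ)] with L hL
    have hL0 : 0 < L := lt_of_le_of_lt (Nat.cast_nonneg m) hL
    rw [le_div_iff₀ hL0, sub_mul, div_mul_cancel₀ _ hL0.ne']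
    linarith [hlo L hL]
  · filter_upwards [eventually_gt_atTop (0:ℝ)] with L hL
    rw [div_le_iff₀ hL]
    linarith [hup L hL]
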